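/- Let Q : ℝ → GL(2N,ℂ) be a differentiable matrix-valued function with Q(t) ∈ 𝕜 for all t, let Λ be the 2N×2N shift matrix (Λ has entry 1 in positions (a, a+1) and 0 elsewhere), and fix an integer i ≥ 1. Define L(t) = Q(t) Λ Q(t)⁻¹ and m(t) = Q(t)⁻¹ J (Q(t)⁻¹)ᵀ. Then the following three conditions are equivalent (at every t): (i) Q'(t) Q(t)⁻¹ = -π_𝕜(L(t)ⁱ); (ii) L(t)ⁱ + Q'(t) Q(t)⁻¹ ∈ 𝕟, i.e. it is fixed by 𝒥; (iii) m'(t) = Λⁱ m(t) + m(t) (Λᵀ)ⁱ. -/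

import Mathlib

open Matrix

/-- The `2N×2N` block-diagonal matrix whose diagonal `2×2` blocks all equal `[[0,1],[-1,0]]`. -/
noncomputable def Jmat (N : ℕ) : Matrix (Fin (2 * N)) (Fin (2 * N)) ℂ :=
  Matrix.of fun i j =>
    if i.val / 2 = j.val / 2 then
      if i.val % 2 = 0 ∧ j.val % 2 = 1 then 1
      else if i.val % 2 = 1 ∧ j.val % 2 = 0 then -1
      else 0
    else 0

/-- The involution `𝒥(a) = J aᵀ J`. -/
noncomputable def Jmap (N : ℕ) (a : Matrix (Fin (2 * N)) (Fin (2 * N)) ℂ) :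
    Matrix (Fin (2 * N)) (Fin (2 * N)) ℂ :=
  Jmat N * aᵀ * Jmat N

/-- Strictly block-lower-triangular part `a₋` (with respect to the `2×2` block structure). -/
noncomputable def bLow (N : ℕ) (a : Matrix (Fin (2 * N)) (Fin (2 * N)) ℂ) :
    Matrix (Fin (2 * N)) (Fin (2 * N)) ℂ :=
  Matrix.of fun i j => if j.val / 2 < i.val / 2 then a i j else 0

/-- Block-diagonal part `a₀` (with respect to the `2×2` block structure). -/
noncomputable def bDiag (N : ℕ) (a : Matrix (Fin (2 * N)) (Fin (2 * N)) ℂ) :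
    Matrix (Fin (2 * N)) (Fin (2 * N)) ℂ :=
  Matrix.of fun i j => if i.val / 2 = j.val / 2 then a i j else 0

/-- Strictly block-upper-triangular part `a₊` (with respect to the `2×2` block structure). -/
noncomputable def bUp (N : ℕ) (a : Matrix (Fin (2 * N)) (Fin (2 * N)) ℂ) :
    Matrix (Fin (2 * N)) (Fin (2 * N)) ℂ :=
  Matrix.of fun i j => if i.val / 2 < j.val / 2 then a i j else 0

/-- `a ∈ 𝒟₀⁻`: block diagonal with each diagonal `2×2` block a scalar multiple of `I₂`. -/
def memD0minus (N : ℕ) (a : Matrix (Fin (2 * N)) (Fin (2 * N)) ℂ) : Prop :=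
  (∀ i j, i ≠ j → a i j = 0) ∧
  (∀ i j : Fin (2 * N), i.val / 2 = j.val / 2 → a i i = a j j)

/-- `a ∈ 𝕜`: block lower triangular with block-diagonal part in `𝒟₀⁻`. -/
def memK (N : ℕ) (a : Matrix (Fin (2 * N)) (Fin (2 * N)) ℂ) : Prop :=
  bUp N a = 0 ∧ memD0minus N (bDiag N a)

/-- `a ∈ 𝕟 = sp(2N)`: fixed points of `𝒥`. -/
def memN (N : ℕ) (a : Matrix (Fin (2 * N)) (Fin (2 * N)) ℂ) : Prop :=
  Jmap N a = a

/-- The projection `π_𝕜(a) = (a₋ - 𝒥(a₊)) + (1/2)(a₀ - 𝒥(a₀))`. -/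
noncomputable def piK (N : ℕ) (a : Matrix (Fin (2 * N)) (Fin (2 * N)) ℂ) :
    Matrix (Fin (2 * N)) (Fin (2 * N)) ℂ :=
  (bLow N a - Jmap N (bUp N a)) +
    (1 / 2 : ℂ) • (bDiag N a - Jmap N (bDiag N a))

/-- The shift matrix `Λ`, with entry `1` in positions `(a, a+1)` and `0` elsewhere. -/
noncomputable def shiftMat (N : ℕ) : Matrix (Fin (2 * N)) (Fin (2 * N)) ℂ :=
  Matrix.of fun i j => if j.val = i.val + 1 then 1 else 0

section helpers

abbrev MM (N : ℕ) := Matrix (Fin (2 * N)) (Fin (2 * N)) ℂ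

def sg (N : ℕ) (i : Fin (2 * N)) : Fin (2 * N) :=
  ⟨if i.val % 2 = 0 then i.val + 1 else i.val - 1, by have := i.2; split_ifs <;> omega⟩

noncomputable def sn (N : ℕ) (i : Fin (2 * N)) : ℂ := if i.val % 2 = 0 then 1 else -1

lemma sg_div (N : ℕ) (i : Fin (2 * N)) : (sg N i).val / 2 = i.val / 2 := by
  simp only [sg]; split_ifs <;> omega

lemma sg_sg (N : ℕ) (i : Fin (2 * N)) : sg N (sg N i) = i := by
  apply Fin.ext; simp only [sg]; split_ifs <;> omega

lemma sn_sg (N : ℕ) (i : Fin (2 * N)) : sn N (sg N i) = - sn N i := by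
  simp only [sg, sn]; split_ifs <;> first | omega | simp

lemma sn_sq (N : ℕ) (i : Fin (2 * N)) : sn N i * sn N i = 1 := by
  simp only [sn]; split_ifs <;> simp

lemma Jmat_eq (N : ℕ) (i j : Fin (2 * N)) :
    Jmat N i j = if j = sg N i then sn N i else 0 := by
  simp only [Jmat, sg, sn, Matrix.of_apply, Fin.ext_iff]
  split_ifs <;> first | rfl | omega

lemma Jmat_eq' (N : ℕ) (i j : Fin (2 * N)) :
    Jmat N i j = if i = sg N j then - sn N j else 0 := by
  rw [Jmat_eq]
  by_cases h : j = sg N i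
  · subst h; simp [sg_sg, sn_sg]
  · rw [if_neg h, if_neg]
    rintro rfl; exact h (sg_sg N j).symm

lemma Jmap_apply (N : ℕ) (a : MM N) (i j : Fin (2 * N)) :
    Jmap N a i j = - (sn N i * sn N j * a (sg N j) (sg N i)) := by
  simp only [Jmap, Matrix.mul_apply, Matrix.transpose_apply]
  simp only [Jmat_eq' N _ j, Jmat_eq N i]
  simp
  ring

lemma Jmat_sq (N : ℕ) : Jmat N * Jmat N = -1 := by
  ext i j
  simp only [Matrix.mul_apply, Jmat_eq N i, Jmat_eq' N _ j, Matrix.neg_apply, Matrix.one_apply]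
  by_cases h : i = j
  · subst h; simp [sn_sq]
  · have : sg N i ≠ sg N j := fun e => h (by rw [← sg_sg N i, e, sg_sg])
    simp [h, this.symm]

lemma memK_iff (N : ℕ) (a : MM N) : memK N a ↔
    (∀ i j : Fin (2 * N), i.val / 2 ≤ j.val / 2 → i ≠ j → a i j = 0) ∧
    (∀ i j : Fin (2 * N), i.val / 2 = j.val / 2 → a i i = a j j) := by
  constructor
  · rintro ⟨h1, h2, h3⟩
    refine ⟨fun i j h hn => ?_, fun i j h => ?_⟩
    · rcases h.lt_or_eq with h | h
      · have := congrFun (congrFun h1 i) j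
        simpa [bUp, h] using this
      · have := h2 i j hn
        simpa [bDiag, h] using this
    · simpa [bDiag] using h3 i j h
  · rintro ⟨h1, h2⟩
    refine ⟨?_, ?_, ?_⟩
    · ext i j
      simp only [bUp, Matrix.of_apply, Matrix.zero_apply]
      split_ifs with h
      · exact h1 i j h.le (by rintro rfl; omega)
      · rfl
    · intro i j hn
      simp only [bDiag, Matrix.of_apply]
      split_ifs with h
      · exact h1 i j h.le hn
      · rfl
    · intro i j h
      simpa [bDiag] using h2 i j h

lemma memK_mul (N : ℕ) (a b : MM N) (ha : memK N a) (hb : memK N b) : memK N (a * b) := by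
  rw [memK_iff] at *
  have hd : ∀ i, (a * b) i i = a i i * b i i := by
    intro i
    rw [Matrix.mul_apply]
    refine Finset.sum_eq_single_of_mem i (Finset.mem_univ _) fun k _ hk => ?_
    rcases le_total (i.val / 2) (k.val / 2) with h | h
    · rw [ha.1 i k h hk.symm, zero_mul]
    · rw [hb.1 k i h hk, mul_zero]
  refine ⟨fun i j h hn => ?_, fun i j h => ?_⟩
  · rw [Matrix.mul_apply]
    refine Finset.sum_eq_zero fun k _ => ?_
    by_cases hik : i = k
    · subst hik; rw [hb.1 i j h hn, mul_zero]
    rcases le_total (i.val / 2) (k.val / 2) with h' | h'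
    · rw [ha.1 i k h' hik, zero_mul]
    · by_cases hkj : k = j
      · subst hkj; rw [ha.1 i k h hn, zero_mul]
      · rw [hb.1 k j (h'.trans h) hkj, mul_zero]
  · rw [hd, hd, ha.2 i j h, hb.2 i j h]

def Ksub (N : ℕ) : Submodule ℂ (MM N) where
  carrier := {a | memK N a}
  zero_mem' := by simp [memK_iff]
  add_mem' := by
    intro a b ha hb
    simp only [Set.mem_ofPred_eq, memK_iff] at *
    refine ⟨fun i j h hn => ?_, fun i j h => ?_⟩
    · simp [ha.1 i j h hn, hb.1 i j h hn]
    · simp [ha.2 i j h, hb.2 i j h]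
  smul_mem' := by
    intro c a ha
    simp only [Set.mem_ofPred_eq, memK_iff] at *
    refine ⟨fun i j h hn => ?_, fun i j h => ?_⟩
    · simp [ha.1 i j h hn]
    · simp [ha.2 i j h]

lemma memK_inv (N : ℕ) (a : MM N) (ha : memK N a) (hu : IsUnit a) : memK N a⁻¹ := by
  let f : Ksub N →ₗ[ℂ] Ksub N :=
    (LinearMap.mulLeft ℂ a).restrict (fun b hb => memK_mul N a b ha hb)
  have hf : Function.Injective f := by
    intro x y h
    have h' : a * x.1 = a * y.1 := congrArg Subtype.val h
    exact Subtype.ext (hu.mul_left_cancel h')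
  have hs := LinearMap.surjective_of_injective hf
  have h1 : (1 : MM N) ∈ Ksub N := by
    show memK N 1
    rw [memK_iff]
    exact ⟨fun i j _ hn => Matrix.one_apply_ne hn, by simp⟩
  obtain ⟨x, hx⟩ := hs ⟨1, h1⟩
  have : a * x.1 = 1 := congrArg Subtype.val hx
  rw [Matrix.inv_eq_right_inv this]
  exact x.2

lemma piK_mem (N : ℕ) (a : MM N) : memK N (piK N a) := by
  rw [memK_iff]
  refine ⟨fun i j h hn => ?_, fun i j h => ?_⟩
  · simp only [piK, bLow, bUp, bDiag, Matrix.add_apply, Matrix.sub_apply, Matrix.smul_apply,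
      Jmap_apply, Matrix.of_apply, sg_div]
    rcases h.lt_or_eq with h | h
    · simp [h.ne, h.ne', not_lt.2 h.le]
    · have hj : j = sg N i := by
        apply Fin.ext
        have : i.val ≠ j.val := fun e => hn (Fin.ext e)
        simp only [sg]; split_ifs <;> omega
      subst hj
      simp [sg_sg, sn_sg, sg_div, sn_sq]
  · by_cases e : i = j
    · rw [e]
    have hj : j = sg N i := by
      apply Fin.ext
      have : i.val ≠ j.val := fun e' => e (Fin.ext e')
      simp only [sg]; split_ifs <;> omega
    subst hj
    simp [piK, bLow, bUp, bDiag, Jmap_apply, sg_div, sg_sg, sn_sg, sn_sq]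
    ring

lemma sub_piK (N : ℕ) (a : MM N) : Jmap N (a - piK N a) = a - piK N a := by
  ext i j
  simp only [piK, bLow, bUp, bDiag, Matrix.add_apply, Matrix.sub_apply, Matrix.smul_apply,
      Jmap_apply, Matrix.of_apply, sg_div, sg_sg, sn_sg, smul_eq_mul]
  have h1 := sn_sq N i
  have h2 := sn_sq N j
  rcases lt_trichotomy (i.val / 2) (j.val / 2) with h | h | h
  · simp [h, h.ne, h.ne', not_lt.2 h.le]
    linear_combination (a i j) * (sn N j * sn N j * h1 + h2)
  · simp [h]
    linear_combination (1 / 2 : ℂ) * (a i j) * (sn N j * sn N j * h1 + h2)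
  · simp [h, h.ne, h.ne', not_lt.2 h.le]

lemma K_inter_N (N : ℕ) (b : MM N) (hk : memK N b) (hn : Jmap N b = b) : b = 0 := by
  rw [memK_iff] at hk
  ext i j
  have h := congrFun (congrFun hn i) j
  rw [Jmap_apply] at h
  simp only [Matrix.zero_apply]
  by_cases e : i = j
  · subst e
    rw [sn_sq, ← hk.2 i (sg N i) (sg_div N i).symm] at h
    linear_combination (-1 / 2 : ℂ) * h
  rcases le_total (i.val / 2) (j.val / 2) with h' | h'
  · exact hk.1 i j h' e
  · rw [← h, hk.1 (sg N j) (sg N i) (by simpa [sg_div] using h')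
      (fun e' => e (by rw [← sg_sg N i, ← e', sg_sg]))]
    simp

lemma Jmap_add (N : ℕ) (a b : MM N) : Jmap N (a + b) = Jmap N a + Jmap N b := by
  simp [Jmap, Matrix.mul_add, Matrix.add_mul]

lemma deriv_mul_entry (N : ℕ) (A B : ℝ → MM N) (A' B' : MM N) (t : ℝ)
    (hA : ∀ a b, HasDerivAt (fun s => A s a b) (A' a b) t)
    (hB : ∀ a b, HasDerivAt (fun s => B s a b) (B' a b) t) (a b : Fin (2 * N)) :
    HasDerivAt (fun s => (A s * B s) a b) ((A' * B t + A t * B') a b) t := by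
  simp only [Matrix.mul_apply, Matrix.add_apply, ← Finset.sum_add_distrib]
  exact HasDerivAt.fun_sum fun k _ => (hA a k).mul (hB k b)

end helpers

theorem pfaff_lattice_three_equivalences (N : ℕ) (hN : 1 ≤ N) (i : ℕ) (hi : 1 ≤ i)
    (Q Q' m m' L : ℝ → Matrix (Fin (2 * N)) (Fin (2 * N)) ℂ)
    (hQk : ∀ t, memK N (Q t)) (hQu : ∀ t, IsUnit (Q t))
    (hQd : ∀ (a b : Fin (2 * N)) (t : ℝ), HasDerivAt (fun s => Q s a b) (Q' t a b) t)
    (hL : ∀ t, L t = Q t * shiftMat N * (Q t)⁻¹)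
    (hm : ∀ t, m t = (Q t)⁻¹ * Jmat N * ((Q t)⁻¹)ᵀ)
    (hmd : ∀ (a b : Fin (2 * N)) (t : ℝ), HasDerivAt (fun s => m s a b) (m' t a b) t) :
    ∀ t : ℝ,
      ((Q' t * (Q t)⁻¹ = -piK N ((L t) ^ i)) ↔
        (Jmap N ((L t) ^ i + Q' t * (Q t)⁻¹) = (L t) ^ i + Q' t * (Q t)⁻¹)) ∧
      ((Q' t * (Q t)⁻¹ = -piK N ((L t) ^ i)) ↔
        (m' t = (shiftMat N) ^ i * m t + m t * ((shiftMat N)ᵀ) ^ i)) := by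
  intro t
  have hdet : ∀ s, IsUnit (Q s).det := fun s => (Matrix.isUnit_iff_isUnit_det _).1 (hQu s)
  have hQi : ∀ s, Q s * (Q s)⁻¹ = 1 := fun s => Matrix.mul_nonsing_inv _ (hdet s)
  have hiQ : ∀ s, (Q s)⁻¹ * Q s = 1 := fun s => Matrix.nonsing_inv_mul _ (hdet s)
  have hQ'k : memK N (Q' t) := by
    have hk : ∀ s, _ := fun s => (memK_iff N (Q s)).1 (hQk s)
    rw [memK_iff]
    refine ⟨fun a b h hn => ?_, fun a b h => ?_⟩
    · have h1 := hQd a b t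
      have h2 : (fun s => Q s a b) = fun _ => 0 := funext fun s => (hk s).1 a b h hn
      rw [h2] at h1
      exact h1.unique (hasDerivAt_const t 0)
    · have h1 := hQd a a t
      have h2 : (fun s => Q s a a) = fun s => Q s b b := funext fun s => (hk s).2 a b h
      rw [h2] at h1
      exact h1.unique (hQd b b t)
  have hBk : memK N (Q' t * (Q t)⁻¹) := memK_mul N _ _ hQ'k (memK_inv N _ (hQk t) (hQu t))
  have hLi : (L t) ^ i = Q t * shiftMat N ^ i * (Q t)⁻¹ := by
    clear hi
    induction i with
    | zero => simp [hQi]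
    | succ n ih =>
      rw [pow_succ, ih, hL, pow_succ]
      calc _ = Q t * shiftMat N ^ n * ((Q t)⁻¹ * Q t) * shiftMat N * (Q t)⁻¹ := by
            simp only [Matrix.mul_assoc]
        _ = _ := by rw [hiQ]; simp only [Matrix.mul_assoc, Matrix.one_mul]
  have e12 : (Q' t * (Q t)⁻¹ = -piK N ((L t) ^ i)) ↔
        (Jmap N ((L t) ^ i + Q' t * (Q t)⁻¹) = (L t) ^ i + Q' t * (Q t)⁻¹) := by
    constructor
    · intro h
      rw [h, ← sub_eq_add_neg]
      exact sub_piK N _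
    · intro h
      rw [eq_neg_iff_add_eq_zero]
      apply K_inter_N N _ ((Ksub N).add_mem hBk (piK_mem N _))
      have h2 : (L t) ^ i + Q' t * (Q t)⁻¹ = ((L t) ^ i - piK N ((L t) ^ i))
          + (Q' t * (Q t)⁻¹ + piK N ((L t) ^ i)) := by abel
      rw [h2, Jmap_add, sub_piK] at h
      exact add_left_cancel h
  refine ⟨e12, e12.trans ?_⟩
  have hTi : ∀ s, ((Q s)⁻¹)ᵀ * (Q s)ᵀ = 1 := fun s => by
    rw [← Matrix.transpose_mul, hQi, Matrix.transpose_one]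
  have hiT : ∀ s, (Q s)ᵀ * ((Q s)⁻¹)ᵀ = 1 := fun s => by
    rw [← Matrix.transpose_mul, hiQ, Matrix.transpose_one]
  have hQm : ∀ s, Q s * m s = Jmat N * ((Q s)⁻¹)ᵀ := fun s => by
    rw [hm, ← Matrix.mul_assoc, ← Matrix.mul_assoc, hQi, Matrix.one_mul]
  have hmQ : ∀ s, m s * (Q s)ᵀ = (Q s)⁻¹ * Jmat N := fun s => by
    rw [hm, Matrix.mul_assoc, hTi, Matrix.mul_one]
  have hJ : ∀ s, Q s * m s * (Q s)ᵀ = Jmat N := fun s => by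
    rw [hQm, Matrix.mul_assoc, hTi, Matrix.mul_one]
  have hder : (Q' t * m t + Q t * m' t) * (Q t)ᵀ + Q t * m t * (Q' t)ᵀ = 0 := by
    ext a b
    have h1 := deriv_mul_entry N (fun s => Q s * m s) (fun s => (Q s)ᵀ) _ ((Q' t)ᵀ) t
      (deriv_mul_entry N Q m _ _ t (fun a b => hQd a b t) (fun a b => hmd a b t))
      (fun a b => hQd b a t) a b
    simp only [hJ] at h1
    exact h1.unique (hasDerivAt_const t _)
  set P := Q' t * (Q t)⁻¹ with hP
  have hder2 : Q t * m' t * (Q t)ᵀ = -(P * Jmat N + Jmat N * Pᵀ) := by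
    have e1 : Q' t * m t * (Q t)ᵀ = P * Jmat N := by
      rw [Matrix.mul_assoc, hmQ, hP, Matrix.mul_assoc]
    have e2 : Q t * m t * (Q' t)ᵀ = Jmat N * Pᵀ := by
      rw [hQm, hP, Matrix.transpose_mul, Matrix.mul_assoc]
    rw [Matrix.add_mul, e1, e2] at hder
    rw [eq_neg_iff_add_eq_zero, ← hder]; abel
  have hrhs : Q t * (shiftMat N ^ i * m t + m t * (shiftMat N)ᵀ ^ i) * (Q t)ᵀ
      = (L t) ^ i * Jmat N + Jmat N * ((L t) ^ i)ᵀ := by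
    rw [Matrix.mul_add, Matrix.add_mul]
    congr 1
    · rw [hLi, Matrix.mul_assoc, Matrix.mul_assoc, hmQ]; simp only [Matrix.mul_assoc]
    · rw [← Matrix.mul_assoc, hQm, hLi, Matrix.transpose_mul, Matrix.transpose_mul,
        Matrix.transpose_pow]
      simp only [Matrix.mul_assoc]
  have e3 : (m' t = shiftMat N ^ i * m t + m t * (shiftMat N)ᵀ ^ i) ↔
      Q t * m' t * (Q t)ᵀ = Q t * (shiftMat N ^ i * m t + m t * (shiftMat N)ᵀ ^ i) * (Q t)ᵀ := by
    constructor
    · intro h; rw [h]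
    · intro h
      have hT : IsUnit (Q t)ᵀ := IsUnit.of_mul_eq_one _ (hiT t)
      exact (hQu t).mul_left_cancel (hT.mul_right_cancel h)
  rw [e3, hder2, hrhs]
  set A := (L t) ^ i
  have hJJ := Jmat_sq N
  constructor
  · intro h
    have h2 : (A + P) * Jmat N = - (Jmat N * (A + P)ᵀ) := by
      have h3 := congrArg (fun X => X * Jmat N) h
      simp only [Jmap] at h3
      rw [Matrix.mul_assoc, hJJ] at h3
      rw [← h3]; simp
    rw [Matrix.add_mul, Matrix.transpose_add, Matrix.mul_add] at h2
    rw [eq_comm, ← sub_eq_zero] at h2 ⊢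
    rw [← neg_eq_zero, ← h2]; abel
  · intro h
    have h2 : Jmat N * (A + P)ᵀ = - ((A + P) * Jmat N) := by
      rw [Matrix.add_mul, Matrix.transpose_add, Matrix.mul_add]
      rw [eq_comm, ← sub_eq_zero] at h ⊢
      rw [← neg_eq_zero, ← h]; abel
    rw [Jmap, h2, Matrix.neg_mul, Matrix.mul_assoc, hJJ]; simp
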